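/- arXiv:1908.07877 — 7 statements merged into one kernel-verified Lean document; each statement's English description precedes it below -/
import Mathlib

section
/- Let n ≥ 2 and let Φ' = (φ'_n,…,φ'_2) and Φ'' = (φ''_n,…,φ''_2) be admissible sequences such that for every j = 2,…,n the permutations φ'_j and φ''_j of I_{j−1} have the same cycle type (the same multiset of cycle lengths in their cycle decompositions). Then there exists a bijection Γ of ℘₂(I_n) such that σ_{Φ''} = Γ ∘ σ_{Φ'} ∘ Γ⁻¹. -/
/-- `℘₂(I_n)`: the family of 2-element subsets of `I_n = {1,…,n}`. -/
def pairs (n : ℕ) : Set (Finset ℕ) :=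
  {u | u.card = 2 ∧ u ⊆ Finset.Icc 1 n}

/-- The skew of a family of permutations of `{1,…,j-1}`, as a function on all finite sets. -/
def skewMap (c : (j : ℕ) → Equiv.Perm (Finset.Icc 1 (j - 1) : Finset ℕ)) (u : Finset ℕ) :
    Finset ℕ :=
  (u.erase (u.sup id)).image (Equiv.Perm.ofSubtype (c (u.sup id))) ∪ {u.sup id}

lemma skewMap_pair (c : (j : ℕ) → Equiv.Perm (Finset.Icc 1 (j - 1) : Finset ℕ)) {j : ℕ}
    (x : (Finset.Icc 1 (j - 1) : Finset ℕ)) :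
    skewMap c {(x : ℕ), j} = {(c j x : ℕ), j} := by
  have hx : (x : ℕ) < j := by
    have := Finset.mem_Icc.mp x.2
    omega
  have hsup : ({(x : ℕ), j} : Finset ℕ).sup id = j := by
    simp [hx.le]
  have herase : ({(x : ℕ), j} : Finset ℕ).erase j = {(x : ℕ)} := by
    ext a
    simp only [Finset.mem_erase, Finset.mem_insert, Finset.mem_singleton]
    omega
  rw [skewMap, hsup, herase, Finset.image_singleton, Equiv.Perm.ofSubtype_apply_coe]
  rfl

lemma mem_pairs_iff {n : ℕ} {u : Finset ℕ} :
    u ∈ pairs n ↔ ∃ j, j ≤ n ∧ ∃ x : (Finset.Icc 1 (j - 1) : Finset ℕ), u = {(x : ℕ), j} := by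
  constructor
  · rintro ⟨hcard, hsub⟩
    obtain ⟨a, b, hab, rfl⟩ := Finset.card_eq_two.mp hcard
    have ha := Finset.mem_Icc.mp (hsub (Finset.mem_insert_self a {b}))
    have hb := Finset.mem_Icc.mp (hsub (Finset.mem_insert_of_mem (Finset.mem_singleton_self b)))
    rcases hab.lt_or_gt with h | h
    · exact ⟨b, hb.2, ⟨a, Finset.mem_Icc.mpr (by omega)⟩, rfl⟩
    · exact ⟨a, ha.2, ⟨b, Finset.mem_Icc.mpr (by omega)⟩, Finset.pair_comm a b⟩
  · rintro ⟨j, hj, ⟨x, hx⟩, rfl⟩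
    have hx' := Finset.mem_Icc.mp hx
    refine ⟨Finset.card_pair (by dsimp only; omega), fun a ha => ?_⟩
    simp only [Finset.mem_insert, Finset.mem_singleton] at ha
    exact Finset.mem_Icc.mpr (by omega)

lemma skewMap_mapsTo (c : (j : ℕ) → Equiv.Perm (Finset.Icc 1 (j - 1) : Finset ℕ)) (n : ℕ) :
    Set.MapsTo (skewMap c) (pairs n) (pairs n) := by
  intro u hu
  obtain ⟨j, hj, x, rfl⟩ := mem_pairs_iff.mp hu
  exact mem_pairs_iff.mpr ⟨j, hj, c j x, skewMap_pair c x⟩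

lemma skewMap_bijOn (c : (j : ℕ) → Equiv.Perm (Finset.Icc 1 (j - 1) : Finset ℕ)) (n : ℕ) :
    Set.BijOn (skewMap c) (pairs n) (pairs n) := by
  refine Set.InvOn.bijOn (f' := skewMap fun j => (c j)⁻¹) ⟨?_, ?_⟩
    (skewMap_mapsTo c n) (skewMap_mapsTo _ n)
  all_goals
    intro u hu
    obtain ⟨j, -, x, rfl⟩ := mem_pairs_iff.mp hu
    simp [skewMap_pair]

/-- let `Φ' = (φ'_n,…,φ'_2)` and `Φ'' = (φ''_n,…,φ''_2)` be admissible
sequences (here each `φ_j` is given directly as a permutation of `I_{j-1}`) such that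
for each `j = 2,…,n` the permutations `φ'_j` and `φ''_j` have the same cycle type.
If `σ'`, `σ''` are the corresponding skews, then there is a bijection `Γ` of `℘₂(I_n)`
with `σ_{Φ''} = Γ ∘ σ_{Φ'} ∘ Γ⁻¹`, i.e. `σ'' ∘ Γ = Γ ∘ σ'` on `℘₂(I_n)`. -/
theorem skew_same_cycle_type_conjugate
    (n : ℕ) (hn : 2 ≤ n)
    (φ' φ'' : (j : ℕ) → Equiv.Perm (Finset.Icc 1 (j - 1) : Finset ℕ))
    (hcyc : ∀ j, 2 ≤ j → j ≤ n → (φ' j).cycleType = (φ'' j).cycleType)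
    (σ' σ'' : Finset ℕ → Finset ℕ)
    (hσ' : ∀ i j (hi : 1 ≤ i) (hij : i < j) (_ : j ≤ n),
      σ' {i, j} = {(↑(φ' j ⟨i, Finset.mem_Icc.mpr (by omega)⟩) : ℕ), j})
    (hσ'' : ∀ i j (hi : 1 ≤ i) (hij : i < j) (_ : j ≤ n),
      σ'' {i, j} = {(↑(φ'' j ⟨i, Finset.mem_Icc.mpr (by omega)⟩) : ℕ), j}) :
    ∃ Γ : Finset ℕ → Finset ℕ, Set.BijOn Γ (pairs n) (pairs n) ∧
      ∀ u ∈ pairs n, σ'' (Γ u) = Γ (σ' u) := by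
  have hconj : ∀ j, ∃ c : Equiv.Perm (Finset.Icc 1 (j - 1) : Finset ℕ),
      2 ≤ j → j ≤ n → c * φ' j * c⁻¹ = φ'' j := by
    intro j
    by_cases h : 2 ≤ j ∧ j ≤ n
    · obtain ⟨c, hc⟩ := isConj_iff.mp
        (Equiv.Perm.isConj_iff_cycleType_eq.mpr (hcyc j h.1 h.2))
      exact ⟨c, fun _ _ => hc⟩
    · exact ⟨1, fun h₁ h₂ => absurd ⟨h₁, h₂⟩ h⟩
  choose c hc using hconj
  refine ⟨skewMap c, skewMap_bijOn c n, fun u hu => ?_⟩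
  obtain ⟨j, hj, x, rfl⟩ := mem_pairs_iff.mp hu
  have bounds (y : (Finset.Icc 1 (j - 1) : Finset ℕ)) : 1 ≤ (y : ℕ) ∧ (y : ℕ) < j := by
    have := Finset.mem_Icc.mp y.2
    omega
  have hcomm : φ'' j (c j x) = c j (φ' j x) := by
    rw [← hc j (by have := bounds x; omega) hj]
    simp
  rw [skewMap_pair, hσ'' _ j (bounds (c j x)).1 (bounds (c j x)).2 hj,
    hσ' _ j (bounds x).1 (bounds x).2 hj, skewMap_pair]
  simp only [Subtype.coe_eta, hcomm]
end

section
/- Let n ≥ 2, let Φ = (φ_n,…,φ_2) be an admissible sequence and let i₀ ∈ I_n. Then the condition 'for every u ∈ ℘₂(I_n), if i₀ ∈ u then i₀ ∈ σ_Φ(u)' holds if and only if φ_j(i₀) = i₀ for every j with i₀ < j ≤ n. -/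
/-- `Φ = (φ_n,…,φ_2)` is admissible: each `φ_j` is a permutation of `I_{j-1} = {1,…,j-1}`. -/
def Admissible (n : ℕ) (φ : ℕ → ℕ → ℕ) : Prop :=
  ∀ j, 2 ≤ j → j ≤ n → Set.BijOn (φ j) (Set.Icc 1 (j - 1)) (Set.Icc 1 (j - 1))

/-- `σ` agrees with the skew `σ_Φ` on `℘₂(I_n)`:
`σ_Φ({i,j}) = {φ_j(i), j}` for `1 ≤ i < j ≤ n`. -/
def IsSkew (n : ℕ) (φ : ℕ → ℕ → ℕ) (σ : Finset ℕ → Finset ℕ) : Prop :=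
  ∀ i j, 1 ≤ i → i < j → j ≤ n → σ {i, j} = {φ j i, j}

/-- for `i₀ ∈ I_n`, the condition
"for every `u ∈ ℘₂(I_n)`, if `i₀ ∈ u` then `i₀ ∈ σ_Φ(u)`" holds iff
`φ_j(i₀) = i₀` for every `j` with `i₀ < j ≤ n`. -/
theorem skew_keeps_index_iff_fixed
    (n : ℕ) (hn : 2 ≤ n) (φ : ℕ → ℕ → ℕ) (hφ : Admissible n φ)
    (σ : Finset ℕ → Finset ℕ) (hσ : IsSkew n φ σ)
    (i₀ : ℕ) (hi₀ : i₀ ∈ Set.Icc 1 n) :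
    (∀ u ∈ pairs n, i₀ ∈ u → i₀ ∈ σ u) ↔
      (∀ j, i₀ < j → j ≤ n → φ j i₀ = i₀) := by
  constructor
  · intro h j hij hjn
    have hu : ({i₀, j} : Finset ℕ) ∈ pairs n := by
      refine ⟨Finset.card_pair hij.ne, fun x hx => ?_⟩
      rw [Finset.mem_insert, Finset.mem_singleton] at hx
      rw [Finset.mem_Icc]
      have := hi₀.1
      omega
    have hmem := h _ hu (Finset.mem_insert_self _ _)
    rw [hσ i₀ j hi₀.1 hij hjn, Finset.mem_insert, Finset.mem_singleton] at hmem
    omega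
  · rintro h u ⟨hcard, hsub⟩ hmem
    have key : ∀ i j, 1 ≤ i → i < j → j ≤ n → (i₀ = i ∨ i₀ = j) → i₀ ∈ σ {i, j} := by
      intro i j hi hij hjn hor
      rw [hσ i j hi hij hjn, Finset.mem_insert, Finset.mem_singleton]
      rcases hor with rfl | rfl
      · exact Or.inl (h j hij hjn).symm
      · exact Or.inr rfl
    obtain ⟨a, b, hab, rfl⟩ := Finset.card_eq_two.mp hcard
    have ha := Finset.mem_Icc.mp (hsub (Finset.mem_insert_self a {b}))
    have hb := Finset.mem_Icc.mp
      (hsub (Finset.mem_insert_of_mem (Finset.mem_singleton_self b)))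
    rw [Finset.mem_insert, Finset.mem_singleton] at hmem
    rcases lt_or_gt_of_ne hab with hlt | hgt
    · exact key a b ha.1 hlt hb.2 hmem
    · rw [Finset.pair_comm]
      exact key b a hb.1 hgt ha.2 hmem.symm
end

section
/- Let n ≥ 3 and let Φ = (φ_n,…,φ_2) be an admissible sequence. Assume that φ_n has no fixed point, or that φ_n and φ_{n−1} have no common fixed point and φ_n(n−1) ≠ n−1. Then i₀ = n is the unique element of I_n such that φ_j(i₀) = i₀ for every j with i₀ < j ≤ n; equivalently, n is the unique i₀ ∈ I_n such that for every u ∈ ℘₂(I_n), i₀ ∈ u implies i₀ ∈ σ_Φ(u). -/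
/-- An index is kept by the skew in every pair containing it if and only if it is fixed by
every later permutation. -/
theorem IsSkew.kept_iff {n : ℕ} {φ : ℕ → ℕ → ℕ} {σ : Finset ℕ → Finset ℕ}
    (hσ : IsSkew n φ σ) {i₀ : ℕ} (hi₀ : 1 ≤ i₀) :
    (∀ u ∈ pairs n, i₀ ∈ u → i₀ ∈ σ u) ↔ ∀ j, i₀ < j → j ≤ n → φ j i₀ = i₀ := by
  constructor
  · intro h j hij hjn
    have hu : ({i₀, j} : Finset ℕ) ∈ pairs n := by
      refine ⟨Finset.card_pair hij.ne, ?_⟩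
      intro x hx
      simp only [Finset.mem_insert, Finset.mem_singleton] at hx
      rw [Finset.mem_Icc]
      omega
    have hk := h _ hu (by simp)
    rw [hσ i₀ j hi₀ hij hjn] at hk
    simp only [Finset.mem_insert, Finset.mem_singleton] at hk
    omega
  · rintro h u ⟨hcard, hsub⟩ hmem
    obtain ⟨a, ha, hau⟩ : ∃ a, a ≠ i₀ ∧ u = {i₀, a} := by
      obtain ⟨x, y, hxy, rfl⟩ := Finset.card_eq_two.mp hcard
      simp only [Finset.mem_insert, Finset.mem_singleton] at hmem
      rcases hmem with rfl | rfl
      · exact ⟨y, hxy.symm, rfl⟩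
      · exact ⟨x, hxy, Finset.pair_comm _ _⟩
    subst hau
    have hi := Finset.mem_Icc.mp (hsub (by simp : i₀ ∈ ({i₀, a} : Finset ℕ)))
    have hj := Finset.mem_Icc.mp (hsub (by simp : a ∈ ({i₀, a} : Finset ℕ)))
    rcases lt_or_gt_of_ne ha with hlt | hlt
    · rw [Finset.pair_comm, hσ a i₀ hj.1 hlt hi.2]
      simp
    · rw [hσ i₀ a hi₀ hlt hj.2, h a hlt hj.2]
      simp

/-- assume `φ_n` has no fixed point (on its domain `I_{n-1}`), or
`φ_n` and `φ_{n-1}` have no common fixed point (on `I_{n-2}`) and `φ_n(n-1) ≠ n-1`.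
Then `i₀ = n` is the unique element of `I_n` with `φ_j(i₀) = i₀` for every
`i₀ < j ≤ n`; equivalently, `n` is the unique `i₀ ∈ I_n` such that for every
`u ∈ ℘₂(I_n)`, `i₀ ∈ u` implies `i₀ ∈ σ_Φ(u)`. -/
theorem unique_kept_index
    (n : ℕ) (hn : 3 ≤ n) (φ : ℕ → ℕ → ℕ) (hφ : Admissible n φ)
    (σ : Finset ℕ → Finset ℕ) (hσ : IsSkew n φ σ)
    (hfix : (∀ i ∈ Set.Icc 1 (n - 1), φ n i ≠ i) ∨
      ((∀ i ∈ Set.Icc 1 (n - 2), φ n i ≠ i ∨ φ (n - 1) i ≠ i) ∧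
        φ n (n - 1) ≠ n - 1)) :
    (∀ i₀ ∈ Set.Icc 1 n,
        ((∀ j, i₀ < j → j ≤ n → φ j i₀ = i₀) ↔ i₀ = n)) ∧
    (∀ i₀ ∈ Set.Icc 1 n,
        ((∀ u ∈ pairs n, i₀ ∈ u → i₀ ∈ σ u) ↔ i₀ = n)) := by
  have hmain : ∀ i₀ ∈ Set.Icc 1 n,
      ((∀ j, i₀ < j → j ≤ n → φ j i₀ = i₀) ↔ i₀ = n) := by
    rintro i₀ ⟨h1, hin⟩
    constructor
    · intro h
      by_contra hne
      have hlt : i₀ < n := lt_of_le_of_ne hin hne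
      have hfixn := h n hlt le_rfl
      rcases hfix with hfree | ⟨hcommon, hlast⟩
      · exact hfree i₀ ⟨h1, by omega⟩ hfixn
      · by_cases heq : i₀ = n - 1
        · subst heq
          exact hlast hfixn
        · rcases hcommon i₀ ⟨h1, by omega⟩ with hc | hc
          · exact hc hfixn
          · exact hc (h (n - 1) (by omega) (by omega))
    · rintro rfl j hij hjn
      omega
  exact ⟨hmain, fun i₀ hi₀ => (hσ.kept_iff hi₀.1).trans (hmain i₀ hi₀)⟩
end

section
/- Let n ≥ 3 and i₀ ∈ I_n. Then the condition 'for every u ∈ ℘₂(I_n), if i₀ ∈ u then i₀ ∈ ζ_n(u)' holds if and only if i₀ = n. -/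
/-- `z` agrees with `ζ_n` on `℘₂(I_n)`: `ζ_n({i,j}) = {j-i, j}` for `1 ≤ i < j ≤ n`. -/
def IsZeta (n : ℕ) (z : Finset ℕ → Finset ℕ) : Prop :=
  ∀ i j, 1 ≤ i → i < j → j ≤ n → z {i, j} = {j - i, j}

/-- for `n ≥ 3` and `i₀ ∈ I_n`, the condition
"for every `u ∈ ℘₂(I_n)`, if `i₀ ∈ u` then `i₀ ∈ ζ_n(u)`" holds iff `i₀ = n`. -/
theorem zeta_keeps_index_iff_top
    (n : ℕ) (hn : 3 ≤ n) (z : Finset ℕ → Finset ℕ) (hz : IsZeta n z)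
    (i₀ : ℕ) (hi₀ : i₀ ∈ Set.Icc 1 n) :
    (∀ u ∈ pairs n, i₀ ∈ u → i₀ ∈ z u) ↔ i₀ = n := by
  obtain ⟨h1, hin⟩ := hi₀
  constructor
  · intro h
    by_contra hne
    obtain ⟨j, hij, hjn, hj⟩ : ∃ j, i₀ < j ∧ j ≤ n ∧ j ≠ 2 * i₀ := by
      by_cases h2 : n = 2 * i₀
      · exact ⟨n - 1, by omega, by omega, by omega⟩
      · exact ⟨n, by omega, le_rfl, h2⟩
    have hmem : ({i₀, j} : Finset ℕ) ∈ pairs n := by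
      refine ⟨Finset.card_pair hij.ne, ?_⟩
      intro x hx
      simp only [Finset.mem_insert, Finset.mem_singleton] at hx
      rw [Finset.mem_Icc]
      omega
    have hz' := h _ hmem (by simp)
    rw [hz i₀ j h1 hij hjn] at hz'
    simp only [Finset.mem_insert, Finset.mem_singleton] at hz'
    omega
  · rintro rfl u ⟨hcard, hsub⟩ hu
    obtain ⟨k, hk⟩ : ∃ k, u.erase i₀ = {k} := by
      rw [← Finset.card_eq_one, Finset.card_erase_of_mem hu, hcard]
    have hku : k ∈ u.erase i₀ := by simp [hk]
    obtain ⟨hne, hku⟩ := Finset.mem_erase.mp hku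
    have hkI := Finset.mem_Icc.mp (hsub hku)
    have hpair : u = {k, i₀} := by
      rw [← Finset.insert_erase hu, hk, Finset.pair_comm]
    rw [hpair, hz k i₀ hkI.1 (by omega) le_rfl]
    simp
end

section
/- Let n > 3, let Φ = (φ_n,…,φ_2) be an admissible sequence and let k ∈ I_n with k > 3. The following are equivalent: (i) for every i ∈ I_n with i ≠ k there exists j ∈ I_n with j ≠ k such that σ_Φ({k,j}) = {k,i}; (ii) k = n, or k < n and φ_j(k) = k for every j with k < j ≤ n. -/
/-- for `n > 3` and `k ∈ I_n` with `k > 3` the following are equivalent: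
(i) for every `i ∈ I_n`, `i ≠ k`, there is `j ∈ I_n`, `j ≠ k`, with `σ_Φ({k,j}) = {k,i}`;
(ii) `k = n`, or `k < n` and `φ_j(k) = k` for every `j` with `k < j ≤ n`. -/
theorem cross_condition_iff
    (n : ℕ) (hn : 3 < n) (φ : ℕ → ℕ → ℕ) (hφ : Admissible n φ)
    (σ : Finset ℕ → Finset ℕ) (hσ : IsSkew n φ σ)
    (k : ℕ) (hk : k ∈ Set.Icc 1 n) (hk3 : 3 < k) :
    (∀ i ∈ Set.Icc 1 n, i ≠ k →
        ∃ j ∈ Set.Icc 1 n, j ≠ k ∧ σ {k, j} = ({k, i} : Finset ℕ)) ↔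
      (k = n ∨ (k < n ∧ ∀ j, k < j → j ≤ n → φ j k = k)) := by
  obtain ⟨hk1, hkn⟩ := hk
  constructor
  · intro h
    rcases hkn.eq_or_lt with rfl | hlt
    · exact Or.inl rfl
    refine Or.inr ⟨hlt, fun i hki hin => ?_⟩
    obtain ⟨j, ⟨hj1, hjn⟩, hjk, hσj⟩ := h i ⟨by omega, hin⟩ (by omega)
    rcases lt_or_gt_of_ne hjk with hj | hj
    · rw [Finset.pair_comm, hσ j k hj1 hj hkn] at hσj
      have hmem := (hφ k (by omega) hkn).mapsTo (show j ∈ Set.Icc 1 (k - 1) from ⟨hj1, by omega⟩)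
      have hi : i ∈ ({φ k j, k} : Finset ℕ) := by simp [hσj]
      simp only [Finset.mem_insert, Finset.mem_singleton] at hi
      simp only [Set.mem_Icc] at hmem
      omega
    · rw [hσ k j hk1 hj hjn] at hσj
      have hj' : j ∈ ({k, i} : Finset ℕ) := by simp [← hσj]
      have hk' : k ∈ ({φ j k, j} : Finset ℕ) := by simp [hσj]
      simp only [Finset.mem_insert, Finset.mem_singleton] at hj' hk'
      obtain rfl : j = i := by omega
      omega
  · rintro h i ⟨hi1, hin⟩ hik
    rcases lt_or_gt_of_ne hik with hi | hi
    · obtain ⟨j, ⟨hj1, hjk⟩, hj⟩ := (hφ k (by omega) hkn).surjOn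
        (show i ∈ Set.Icc 1 (k - 1) from ⟨hi1, by omega⟩)
      refine ⟨j, ⟨hj1, by omega⟩, by omega, ?_⟩
      rw [Finset.pair_comm, hσ j k hj1 (by omega) hkn, hj, Finset.pair_comm]
    · refine ⟨i, ⟨hi1, hin⟩, hik, ?_⟩
      rcases h with rfl | ⟨-, h⟩
      · omega
      · rw [hσ k i hk1 hi hin, h i hi hin]
end

section
/- Let n > 3 and let φ be a permutation of I_n such that φ̄ ∘ ζ_n = ζ_n ∘ φ̄ (equivalently, the conjugate of ζ_n by the induced permutation φ̄ equals ζ_n). Then φ is the identity of I_n. -/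
theorem IsZeta.apply_of_ne {n : ℕ} {z : Finset ℕ → Finset ℕ} (hz : IsZeta n z) {a b : ℕ}
    (ha : a ∈ Set.Icc 1 n) (hb : b ∈ Set.Icc 1 n) (hab : a ≠ b) :
    (a < b ∧ z {a, b} = {b - a, b}) ∨ (b < a ∧ z {a, b} = {a - b, a}) := by
  rcases hab.lt_or_gt with h | h
  · exact Or.inl ⟨h, hz a b ha.1 h hb.2⟩
  · exact Or.inr ⟨h, Finset.pair_comm b a ▸ hz b a hb.1 h ha.2⟩

/-- A map commuting with `ζ_n` sends `{j - i, j}` to the value of `ζ_n` at `{φ i, φ j}`. -/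
theorem IsZeta.pair_map_eq {n : ℕ} {z : Finset ℕ → Finset ℕ} (hz : IsZeta n z) {φ : ℕ → ℕ}
    (hcomm : ∀ u ∈ pairs n, Finset.image φ (z u) = z (Finset.image φ u))
    {i j : ℕ} (hi : 1 ≤ i) (hij : i < j) (hj : j ≤ n) :
    ({φ (j - i), φ j} : Finset ℕ) = z {φ i, φ j} := by
  have hmem : ({i, j} : Finset ℕ) ∈ pairs n := by
    refine ⟨Finset.card_pair hij.ne, fun x hx => ?_⟩
    simp only [Finset.mem_insert, Finset.mem_singleton] at hx
    rw [Finset.mem_Icc]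
    omega
  simpa [hz i j hi hij hj, Finset.image_insert] using hcomm _ hmem

/-- A permutation commuting with `ζ_n` is additive on distinct summands. -/
theorem IsZeta.map_add {n : ℕ} {z : Finset ℕ → Finset ℕ} (hz : IsZeta n z) {φ : ℕ → ℕ}
    (hφ : Set.BijOn φ (Set.Icc 1 n) (Set.Icc 1 n))
    (hcomm : ∀ u ∈ pairs n, Finset.image φ (z u) = z (Finset.image φ u))
    {i k : ℕ} (hi : 1 ≤ i) (hk : 1 ≤ k) (hik : i ≠ k) (hn : i + k ≤ n) :
    φ (i + k) = φ i + φ k := by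
  have mi : i ∈ Set.Icc 1 n := ⟨hi, by omega⟩
  have mk : k ∈ Set.Icc 1 n := ⟨hk, by omega⟩
  have mj : i + k ∈ Set.Icc 1 n := ⟨by omega, hn⟩
  have hne : φ i ≠ φ (i + k) := fun h => by have := hφ.injOn mi mj h; omega
  have hne' : φ i ≠ φ k := fun h => hik (hφ.injOn mi mk h)
  have hne'' : φ k ≠ φ (i + k) := fun h => by have := hφ.injOn mk mj h; omega
  have key := hz.pair_map_eq hcomm hi (show i < i + k by omega) hn
  rw [Nat.add_sub_cancel_left] at key
  rcases hz.apply_of_ne (hφ.mapsTo mi) (hφ.mapsTo mj) hne with ⟨hlt, he⟩ | ⟨hlt, he⟩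
  · have hm : φ k ∈ ({φ k, φ (i + k)} : Finset ℕ) := by simp
    rw [key, he] at hm
    simp only [Finset.mem_insert, Finset.mem_singleton] at hm
    omega
  · have hm : φ i ∈ ({φ k, φ (i + k)} : Finset ℕ) := by rw [key, he]; simp
    simp only [Finset.mem_insert, Finset.mem_singleton] at hm
    omega

/-- For a permutation commuting with `ζ_n`, one of `φ i`, `φ (2 * i)` is twice the other. -/
theorem IsZeta.map_two_mul {n : ℕ} {z : Finset ℕ → Finset ℕ} (hz : IsZeta n z) {φ : ℕ → ℕ}
    (hφ : Set.BijOn φ (Set.Icc 1 n) (Set.Icc 1 n))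
    (hcomm : ∀ u ∈ pairs n, Finset.image φ (z u) = z (Finset.image φ u))
    {i : ℕ} (hi : 1 ≤ i) (hn : 2 * i ≤ n) :
    φ (2 * i) = 2 * φ i ∨ φ i = 2 * φ (2 * i) := by
  have mi : i ∈ Set.Icc 1 n := ⟨hi, by omega⟩
  have mj : 2 * i ∈ Set.Icc 1 n := ⟨by omega, hn⟩
  have hne : φ i ≠ φ (2 * i) := fun h => by have := hφ.injOn mi mj h; omega
  have key := hz.pair_map_eq hcomm hi (show i < 2 * i by omega) hn
  rw [show 2 * i - i = i by omega] at key
  have hpi := (hφ.mapsTo mi).1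
  have hpj := (hφ.mapsTo mj).1
  rcases hz.apply_of_ne (hφ.mapsTo mi) (hφ.mapsTo mj) hne with ⟨hlt, he⟩ | ⟨hlt, he⟩
  · have hm : φ i ∈ ({φ i, φ (2 * i)} : Finset ℕ) := by simp
    rw [key, he] at hm
    simp only [Finset.mem_insert, Finset.mem_singleton] at hm
    omega
  · have hm : φ (2 * i) ∈ ({φ i, φ (2 * i)} : Finset ℕ) := by simp
    rw [key, he] at hm
    simp only [Finset.mem_insert, Finset.mem_singleton] at hm
    omega

/-- for `n > 3`, if `φ` is a permutation of `I_n` whose induced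
permutation `φ̄` of `℘₂(I_n)` (given by `φ̄({i,j}) = {φ(i),φ(j)}`, i.e. by taking
images of pairs) commutes with `ζ_n`, then `φ` is the identity of `I_n`. -/
theorem zeta_centralizer_trivial
    (n : ℕ) (hn : 3 < n) (z : Finset ℕ → Finset ℕ) (hz : IsZeta n z)
    (φ : ℕ → ℕ) (hφ : Set.BijOn φ (Set.Icc 1 n) (Set.Icc 1 n))
    (hcomm : ∀ u ∈ pairs n, Finset.image φ (z u) = z (Finset.image φ u)) :
    ∀ i ∈ Set.Icc 1 n, φ i = i := by
  have h3 : φ 3 = φ 1 + φ 2 :=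
    hz.map_add hφ hcomm (i := 1) (k := 2) le_rfl (by omega) (by omega) (by omega)
  have h4 : φ 4 = φ 1 + φ 3 :=
    hz.map_add hφ hcomm (i := 1) (k := 3) le_rfl (by omega) (by omega) (by omega)
  have h24 : φ 4 = 2 * φ 2 ∨ φ 2 = 2 * φ 4 :=
    hz.map_two_mul hφ hcomm (i := 2) (by omega) (by omega)
  have hp : 1 ≤ φ 1 := (hφ.mapsTo ⟨le_rfl, by omega⟩).1
  have h2 : φ 2 = 2 * φ 1 := by omega
  have hlin : ∀ k, 2 ≤ k → k ≤ n → φ k = k * φ 1 := by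
    intro k hk
    induction k, hk using Nat.le_induction with
    | base => exact fun _ => h2
    | succ k hk ih =>
      intro hkn
      rw [hz.map_add hφ hcomm (by omega) le_rfl (by omega) hkn, ih (by omega)]
      ring
  have hle : φ n ≤ n := (hφ.mapsTo ⟨by omega, le_rfl⟩).2
  have h1 : φ 1 = 1 := by
    rw [hlin n (by omega) le_rfl] at hle
    nlinarith
  rintro i ⟨hi, hin⟩
  rcases hi.eq_or_lt with rfl | hi
  · exact h1
  · rw [hlin i hi hin, h1, mul_one]
end

section
/- Let n > 3. Then there is no 3-element subset Y of I_n such that the image {ζ_n({1,2}), ζ_n({1,n}), ζ_n({2,n})} of the line ℘₂({1,2,n}) under ζ_n equals ℘₂(Y). Consequently, ζ_n does not map the family of lines {℘₂(Y) : Y a 3-element subset of I_n} of the combinatorial Grassmannian G(I_n,2) onto itself, i.e. ζ_n(G(I_n,2)) ≠ G(I_n,2). -/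
/-- The lines of the combinatorial Grassmannian `G(I_n,2)`: the families `℘₂(Y)`
for 3-element subsets `Y` of `I_n`. -/
def grasLines (n : ℕ) : Set (Set (Finset ℕ)) :=
  {L | ∃ Y : Finset ℕ, Y ⊆ Finset.Icc 1 n ∧ Y.card = 3 ∧
    L = {u : Finset ℕ | u.card = 2 ∧ u ⊆ Y}}

/-- The `ζ_n`-images of `{1, 2}` and `{1, n}` are disjoint pairs when `n > 3`, so that no
3-element set contains both of them. -/
theorem IsZeta.card_ne_three {n : ℕ} (hn : 3 < n) {z : Finset ℕ → Finset ℕ} (hz : IsZeta n z)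
    {Y : Finset ℕ} (h₂ : z {1, 2} ⊆ Y) (hₙ : z {1, n} ⊆ Y) : Y.card ≠ 3 := by
  rw [hz 1 2 le_rfl (by omega) (by omega)] at h₂
  rw [hz 1 n le_rfl (by omega) le_rfl] at hₙ
  have hsub : ({1, 2} : Finset ℕ) ∪ {n - 1, n} ⊆ Y := Finset.union_subset h₂ hₙ
  have hdisj : Disjoint ({1, 2} : Finset ℕ) {n - 1, n} := by
    simp only [Finset.disjoint_left, Finset.mem_insert, Finset.mem_singleton]
    omega
  have hcard := Finset.card_le_card hsub
  rw [Finset.card_union_of_disjoint hdisj, Finset.card_pair (by omega),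
    Finset.card_pair (by omega)] at hcard
  omega

/-- for `n > 3` there is no 3-element subset `Y` of `I_n` with
`{ζ_n({1,2}), ζ_n({1,n}), ζ_n({2,n})} = ℘₂(Y)`; consequently the family of
`ζ_n`-images of the lines of `G(I_n,2)` differs from the family of lines of
`G(I_n,2)`, i.e. `ζ_n(G(I_n,2)) ≠ G(I_n,2)`. -/
theorem zeta_does_not_preserve_grassmannian
    (n : ℕ) (hn : 3 < n) (z : Finset ℕ → Finset ℕ) (hz : IsZeta n z) :
    (¬ ∃ Y : Finset ℕ, Y ⊆ Finset.Icc 1 n ∧ Y.card = 3 ∧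
        ({z {1, 2}, z {1, n}, z {2, n}} : Set (Finset ℕ)) =
          {u : Finset ℕ | u.card = 2 ∧ u ⊆ Y}) ∧
    (fun L => z '' L) '' grasLines n ≠ grasLines n := by
  refine ⟨?_, fun h => ?_⟩
  · rintro ⟨Y, -, hY, h⟩
    have hmem : ∀ u ∈ ({z {1, 2}, z {1, n}, z {2, n}} : Set (Finset ℕ)), u ⊆ Y :=
      fun u hu => (h ▸ hu : u ∈ {u : Finset ℕ | u.card = 2 ∧ u ⊆ Y}).2
    exact hz.card_ne_three hn (hmem _ (by simp)) (hmem _ (by simp)) hY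
  · have hline : {u : Finset ℕ | u.card = 2 ∧ u ⊆ {1, 2, n}} ∈ grasLines n := by
      refine ⟨{1, 2, n}, ?_, ?_, rfl⟩
      · simp only [Finset.subset_iff, Finset.mem_insert, Finset.mem_singleton, Finset.mem_Icc]
        omega
      · exact Finset.card_eq_three.2 ⟨1, 2, n, by omega, by omega, by omega, rfl⟩
    obtain ⟨Y, -, hY, hL⟩ := h ▸ Set.mem_image_of_mem (fun L => z '' L) hline
    have hmem : ∀ u : Finset ℕ, u.card = 2 → u ⊆ {1, 2, n} → z u ⊆ Y := fun u hu hsub =>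
      (hL.subset (Set.mem_image_of_mem z ⟨hu, hsub⟩)).2
    refine hz.card_ne_three hn (hmem _ (Finset.card_pair (by omega)) ?_)
      (hmem _ (Finset.card_pair (by omega)) ?_) hY <;>
    · simp [Finset.subset_iff]
end
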